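/- For every n ≥ 5, the number of set partitions of [n] avoiding 1/24/3 is strictly less than the number of set partitions of [n] avoiding 1/2/3/4; that is, |Π_n(1/24/3)| < |Π_n(1/2/3/4)|. -/

import Mathlib

open Finset

/-- The ground set `[n] = {1, …, n}`. -/
def Idx (n : ℕ) : Finset ℕ := Finset.Icc 1 n

/-- `i` and `j` lie in the same block of the set partition `π`. -/
def SameBlock {n : ℕ} (π : Finpartition (Idx n)) (i j : ℕ) : Prop :=
  ∃ B ∈ π.parts, i ∈ B ∧ j ∈ B

/-- Klazar containment: `σ ⊢ [n]` contains `τ ⊢ [k]` if there is a strictly increasing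
map `f : [k] → [n]` such that `i, j` are in the same block of `τ` iff `f i, f j` are in
the same block of `σ`. -/
def Contains {k n : ℕ} (τ : Finpartition (Idx k)) (σ : Finpartition (Idx n)) : Prop :=
  ∃ f : ℕ → ℕ, StrictMonoOn f (Idx k) ∧ (∀ i ∈ Idx k, f i ∈ Idx n) ∧
    ∀ i ∈ Idx k, ∀ j ∈ Idx k, (SameBlock τ i j ↔ SameBlock σ (f i) (f j))

/-- `σ` avoids the pattern `τ`. -/
def Avoids {k n : ℕ} (σ : Finpartition (Idx n)) (τ : Finpartition (Idx k)) : Prop :=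
  ¬ Contains τ σ

/-- `|Π_n(τ)|`, the number of set partitions of `[n]` avoiding `τ`. -/
noncomputable def avoidCount (n : ℕ) {k : ℕ} (τ : Finpartition (Idx k)) : ℕ :=
  Nat.card {σ : Finpartition (Idx n) // Avoids σ τ}

/-- `r` sends each `i ∈ [n]` to the least element of its block in some set partition of `[n]`,
and vanishes outside `[n]`. -/
structure IsRep (n : ℕ) (r : ℕ → ℕ) : Prop where
  pos : ∀ i ∈ Idx n, 1 ≤ r i
  le : ∀ i ∈ Idx n, r i ≤ i
  idem : ∀ i ∈ Idx n, r (r i) = r i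
  zero : ∀ i ∉ Idx n, r i = 0

/-- The set partition of `[n]` into the fibres of `r`. -/
def fibrePartition (n : ℕ) (r : ℕ → ℕ) : Finpartition (Idx n) :=
  letI : DecidableRel (Setoid.ker r).r := fun a b => decEq (r a) (r b)
  Finpartition.ofSetSetoid (Setoid.ker r) (Idx n)

/-- The least element of the block of `i`, and `0` if `i ∉ [n]`. -/
def blockMin {n : ℕ} (σ : Finpartition (Idx n)) (i : ℕ) : ℕ :=
  if h : i ∈ Idx n then (σ.part i).min' (σ.part_nonempty.2 h) else 0

lemma mem_Idx {n i : ℕ} : i ∈ Idx n ↔ 1 ≤ i ∧ i ≤ n := by simp [Idx]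

lemma sameBlock_iff_mem_part {n : ℕ} (σ : Finpartition (Idx n)) (i j : ℕ) :
    SameBlock σ i j ↔ i ∈ σ.part j := by
  rw [Finpartition.mem_part_iff_exists]; rfl

lemma sameBlock_fibrePartition {n : ℕ} {r : ℕ → ℕ} {i j : ℕ} (hi : i ∈ Idx n) (hj : j ∈ Idx n) :
    SameBlock (fibrePartition n r) i j ↔ r i = r j := by
  let : DecidableRel (Setoid.ker r).r := fun a b => decEq (r a) (r b)
  rw [sameBlock_iff_mem_part]
  refine (Finpartition.mem_part_ofSetSetoid_iff_rel (s := Setoid.ker r) (Idx n)).trans ?_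
  simp [hi, hj, Setoid.ker_def, eq_comm]

lemma blockMin_mem_part {n : ℕ} (σ : Finpartition (Idx n)) {i : ℕ} (hi : i ∈ Idx n) :
    blockMin σ i ∈ σ.part i := by
  rw [blockMin, dif_pos hi]; exact min'_mem _ _

lemma blockMin_congr {n : ℕ} (σ : Finpartition (Idx n)) {i j : ℕ} (hi : i ∈ Idx n)
    (hj : j ∈ Idx n) (h : σ.part i = σ.part j) : blockMin σ i = blockMin σ j := by
  simp only [blockMin, dif_pos hi, dif_pos hj, h]

lemma sameBlock_iff_blockMin {n : ℕ} (σ : Finpartition (Idx n)) {i j : ℕ} (hi : i ∈ Idx n)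
    (hj : j ∈ Idx n) : SameBlock σ i j ↔ blockMin σ i = blockMin σ j := by
  rw [sameBlock_iff_mem_part, σ.mem_part_iff_part_eq_part hi hj]
  refine ⟨blockMin_congr σ hi hj, fun h => ?_⟩
  have h1 := blockMin_mem_part σ hi
  have h2 := blockMin_mem_part σ hj
  rw [← h] at h2
  rw [← σ.part_eq_of_mem (σ.part_mem.2 hi) h1, σ.part_eq_of_mem (σ.part_mem.2 hj) h2]

lemma isRep_blockMin {n : ℕ} (σ : Finpartition (Idx n)) : IsRep n (blockMin σ) where
  pos i hi := (mem_Idx.1 (σ.part_subset i (blockMin_mem_part σ hi))).1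
  le i hi := by
    rw [blockMin, dif_pos hi]
    exact min'_le _ _ (σ.mem_part hi)
  idem i hi := by
    have h := blockMin_mem_part σ hi
    exact blockMin_congr σ (σ.part_subset i h) hi (σ.part_eq_of_mem (σ.part_mem.2 hi) h)
  zero i hi := by rw [blockMin, dif_neg hi]

lemma finpartition_ext_sameBlock {n : ℕ} {σ ρ : Finpartition (Idx n)}
    (h : ∀ i ∈ Idx n, ∀ j ∈ Idx n, (SameBlock σ i j ↔ SameBlock ρ i j)) : σ = ρ := by
  have key : ∀ i ∈ Idx n, σ.part i = ρ.part i := by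
    intro i hi
    ext j
    constructor
    · intro hj
      have := h j (σ.part_subset i hj) i hi
      rwa [sameBlock_iff_mem_part, sameBlock_iff_mem_part, iff_true_left hj] at this
    · intro hj
      have := h j (ρ.part_subset i hj) i hi
      rwa [sameBlock_iff_mem_part, sameBlock_iff_mem_part, iff_true_right hj] at this
  ext B
  constructor
  · intro hB
    obtain ⟨i, hi⟩ := σ.nonempty_of_mem_parts hB
    have hin : i ∈ Idx n := σ.le hB hi
    rw [← σ.part_eq_of_mem hB hi, key i hin]
    exact ρ.part_mem.2 hin
  · intro hB
    obtain ⟨i, hi⟩ := ρ.nonempty_of_mem_parts hB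
    have hin : i ∈ Idx n := ρ.le hB hi
    rw [← ρ.part_eq_of_mem hB hi, ← key i hin]
    exact σ.part_mem.2 hin

lemma blockMin_injective {n : ℕ} :
    Function.Injective (blockMin : Finpartition (Idx n) → ℕ → ℕ) := by
  intro σ ρ h
  apply finpartition_ext_sameBlock
  intro i hi j hj
  rw [sameBlock_iff_blockMin σ hi hj, sameBlock_iff_blockMin ρ hi hj, h]

lemma IsRep.mem {n : ℕ} {r : ℕ → ℕ} (hr : IsRep n r) {i : ℕ} (hi : i ∈ Idx n) : r i ∈ Idx n :=
  mem_Idx.2 ⟨hr.pos i hi, (hr.le i hi).trans (mem_Idx.1 hi).2⟩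

lemma fibrePartition_injOn (n : ℕ) : Set.InjOn (fibrePartition n) {r | IsRep n r} := by
  intro r hr s hs h
  have key : ∀ i ∈ Idx n, ∀ j ∈ Idx n, (r i = r j ↔ s i = s j) := by
    intro i hi j hj
    rw [← sameBlock_fibrePartition hi hj, ← sameBlock_fibrePartition hi hj, h]
  ext i
  by_cases hi : i ∈ Idx n
  · apply le_antisymm
    · have h1 := (key _ (IsRep.mem hs hi) i hi).2 (hs.idem i hi)
      rw [← h1]
      exact hr.le _ (IsRep.mem hs hi)
    · have h1 := (key _ (IsRep.mem hr hi) i hi).1 (hr.idem i hi)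
      rw [← h1]
      exact hs.le _ (IsRep.mem hr hi)
  · rw [hr.zero i hi, hs.zero i hi]

lemma finite_isRep (n : ℕ) : {r | IsRep n r}.Finite :=
  Set.Finite.of_finite_image (Set.toFinite _) (fibrePartition_injOn n)

/-- The avoidance condition for the pattern `1/24/3`, in terms of representatives. -/
def NoInterrupt (n : ℕ) (r : ℕ → ℕ) : Prop :=
  ∀ a b c d, 1 ≤ a → a < b → b < c → c < d → d ≤ n →
    r b = r d → r a ≠ r b → r b ≠ r c → r a = r c

/-- `r` takes at most three values on `[n]`. -/
def FewValues (n : ℕ) (r : ℕ → ℕ) : Prop :=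
  ∀ a ∈ Idx n, ∀ b ∈ Idx n, ∀ c ∈ Idx n, ∀ d ∈ Idx n,
    r a = r b ∨ r a = r c ∨ r a = r d ∨ r b = r c ∨ r b = r d ∨ r c = r d

/-- Representative functions of the set partitions of `[n]` avoiding `1/24/3`. -/
noncomputable def interruptFree (n : ℕ) : Finset (ℕ → ℕ) :=
  ((finite_isRep n).subset (t := {r | IsRep n r ∧ NoInterrupt n r}) fun _ h => h.1).toFinset

/-- Representative functions of the set partitions of `[n]` with at most three blocks. -/
noncomputable def fewBlocks (n : ℕ) : Finset (ℕ → ℕ) :=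
  ((finite_isRep n).subset (t := {r | IsRep n r ∧ FewValues n r}) fun _ h => h.1).toFinset

lemma mem_interruptFree {n : ℕ} {r : ℕ → ℕ} :
    r ∈ interruptFree n ↔ IsRep n r ∧ NoInterrupt n r := by
  simp [interruptFree]

lemma mem_fewBlocks {n : ℕ} {r : ℕ → ℕ} : r ∈ fewBlocks n ↔ IsRep n r ∧ FewValues n r := by
  simp [fewBlocks]

lemma avoidCount_le_card_interruptFree (τ : Finpartition (Idx 4))
    (hτ : τ.parts = {{1}, {2, 4}, {3}}) (n : ℕ) : avoidCount n τ ≤ #(interruptFree n) := by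
  rw [avoidCount, ← Nat.card_eq_finsetCard]
  refine Nat.card_le_card_of_injective
    (fun σ => ⟨blockMin σ.1, mem_interruptFree.2 ⟨isRep_blockMin σ.1, ?_⟩⟩) ?_
  · intro a b c d ha hab hbc hcd hd hbd hne hbc'
    by_contra hac
    have ma : a ∈ Idx n := mem_Idx.2 (by omega)
    have mb : b ∈ Idx n := mem_Idx.2 (by omega)
    have mc : c ∈ Idx n := mem_Idx.2 (by omega)
    have md : d ∈ Idx n := mem_Idx.2 (by omega)
    apply σ.2
    refine ⟨fun i => if i = 1 then a else if i = 2 then b else if i = 3 then c else d, ?_, ?_, ?_⟩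
    · intro i hi j hj hij
      rw [mem_coe, mem_Idx] at hi hj
      dsimp only
      split_ifs <;> omega
    · intro i _
      dsimp only
      split_ifs <;> assumption
    · intro i hi j hj
      have hL : SameBlock τ i j ↔ (i = 1 ∧ j = 1) ∨ ((i = 2 ∨ i = 4) ∧ (j = 2 ∨ j = 4)) ∨
          (i = 3 ∧ j = 3) := by
        simp [SameBlock, hτ]
      rw [hL, sameBlock_iff_blockMin σ.1 (by dsimp only; split_ifs <;> assumption)
        (by dsimp only; split_ifs <;> assumption)]
      rw [mem_Idx] at hi hj
      obtain ⟨hi1, hi4⟩ := hi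
      obtain ⟨hj1, hj4⟩ := hj
      interval_cases i <;> interval_cases j <;> simp <;> grind
  · intro σ ρ h
    exact Subtype.ext (blockMin_injective (congrArg Subtype.val h))

lemma card_fewBlocks_le_avoidCount (τ : Finpartition (Idx 4))
    (hτ : τ.parts = {{1}, {2}, {3}, {4}}) (n : ℕ) : #(fewBlocks n) ≤ avoidCount n τ := by
  rw [avoidCount, ← Nat.card_eq_finsetCard]
  refine Nat.card_le_card_of_injective (fun r => ⟨fibrePartition n r.1, ?_⟩) ?_
  · rintro ⟨f, -, hf, hsame⟩
    have key : ∀ i ∈ Idx 4, ∀ j ∈ Idx 4, i ≠ j → r.1 (f i) ≠ r.1 (f j) := by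
      intro i hi j hj hij h
      rw [← sameBlock_fibrePartition (hf i hi) (hf j hj), ← hsame i hi j hj, SameBlock, hτ] at h
      simp only [mem_insert, mem_singleton, exists_eq_or_imp, exists_eq_left] at h
      omega
    have m : ∀ i, 1 ≤ i → i ≤ 4 → i ∈ Idx 4 := fun i h1 h2 => mem_Idx.2 ⟨h1, h2⟩
    have h1 := m 1 (by simp) (by simp)
    have h2 := m 2 (by simp) (by simp)
    have h3 := m 3 (by simp) (by simp)
    have h4 := m 4 (by simp) (by simp)
    have h := (mem_fewBlocks.1 r.2).2 _ (hf 1 h1) _ (hf 2 h2) _ (hf 3 h3) _ (hf 4 h4)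
    have := key 1 h1 2 h2
    have := key 1 h1 3 h3
    have := key 1 h1 4 h4
    have := key 2 h2 3 h3
    have := key 2 h2 4 h4
    have := key 3 h3 4 h4
    simp_all
  · intro r s h
    exact Subtype.ext (fibrePartition_injOn n (mem_fewBlocks.1 r.2).1 (mem_fewBlocks.1 s.2).1
      (congrArg Subtype.val h))

/-- Forget the value of `r` at `m`. -/
def erasePoint (m : ℕ) (r : ℕ → ℕ) : ℕ → ℕ := Function.update r m 0

lemma IsRep.erasePoint {n : ℕ} {r : ℕ → ℕ} (hr : IsRep (n + 1) r) :
    IsRep n (erasePoint (n + 1) r) := by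
  have lt : ∀ i ∈ Idx n, i ∈ Idx (n + 1) ∧ i ≠ n + 1 ∧ r i ≠ n + 1 := by
    intro i hi
    have h1 := mem_Idx.1 hi
    have h2 : i ∈ Idx (n + 1) := mem_Idx.2 (by omega)
    have := hr.le i h2
    exact ⟨h2, by omega, by omega⟩
  constructor
  · intro i hi
    obtain ⟨h1, h2, h3⟩ := lt i hi
    simpa [_root_.erasePoint, h2] using hr.pos i h1
  · intro i hi
    obtain ⟨h1, h2, h3⟩ := lt i hi
    simpa [_root_.erasePoint, h2] using hr.le i h1
  · intro i hi
    obtain ⟨h1, h2, h3⟩ := lt i hi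
    simpa [_root_.erasePoint, h2, h3] using hr.idem i h1
  · intro i hi
    by_cases h : i = n + 1
    · simp [_root_.erasePoint, h]
    · simp only [_root_.erasePoint, ne_eq, h, not_false_eq_true, Function.update_of_ne]
      apply hr.zero
      rw [mem_Idx] at *
      omega

lemma erasePoint_apply {n i : ℕ} (r : ℕ → ℕ) (h : i ≤ n) : erasePoint (n + 1) r i = r i := by
  rw [erasePoint, Function.update_of_ne (by omega)]

lemma eq_of_erasePoint_eq {m : ℕ} {r s : ℕ → ℕ} (h : erasePoint m r = erasePoint m s)
    (hm : r m = s m) : r = s := by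
  rw [← Function.update_eq_self m r, ← Function.update_eq_self m s, hm]
  have := congrArg (fun t => Function.update t m (s m)) h
  simpa [erasePoint] using this

lemma erasePoint_mapsTo_interruptFree (n : ℕ) :
    Set.MapsTo (erasePoint (n + 1)) (interruptFree (n + 1)) (interruptFree n) := by
  intro r hr
  rw [mem_coe, mem_interruptFree] at *
  refine ⟨hr.1.erasePoint, ?_⟩
  intro a b c d ha hab hbc hcd hd
  rw [erasePoint_apply r (by omega), erasePoint_apply r (by omega), erasePoint_apply r (by omega),
    erasePoint_apply r (by omega)]
  exact hr.2 a b c d ha hab hbc hcd (by omega)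

lemma erasePoint_mapsTo_fewBlocks (n : ℕ) :
    Set.MapsTo (erasePoint (n + 1)) (fewBlocks (n + 1)) (fewBlocks n) := by
  intro r hr
  rw [mem_coe, mem_fewBlocks] at *
  refine ⟨hr.1.erasePoint, ?_⟩
  have h : ∀ i ∈ Idx n, i ∈ Idx (n + 1) ∧ erasePoint (n + 1) r i = r i := by
    intro i hi
    rw [mem_Idx] at hi
    exact ⟨mem_Idx.2 (by omega), erasePoint_apply r hi.2⟩
  intro a ha b hb c hc d hd
  rw [(h a ha).2, (h b hb).2, (h c hc).2, (h d hd).2]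
  exact hr.2 a (h a ha).1 b (h b hb).1 c (h c hc).1 d (h d hd).1

open scoped Classical in
/-- The extensions of `r` to a representative function on `[n + 1]` that still avoids `1/24/3`. -/
noncomputable def interruptFreeExtensions (n : ℕ) (r : ℕ → ℕ) : Finset (ℕ → ℕ) :=
  {s ∈ interruptFree (n + 1) | erasePoint (n + 1) s = r}

lemma card_interruptFreeExtensions_le {n : ℕ} {r : ℕ → ℕ} {V : Finset ℕ}
    (h : ∀ s ∈ interruptFreeExtensions n r, s (n + 1) ∈ V) :
    #(interruptFreeExtensions n r) ≤ #V := by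
  refine card_le_card_of_injOn (fun s => s (n + 1)) h ?_
  intro s hs t ht hst
  simp only [interruptFreeExtensions, coe_filter, Set.mem_ofPred_eq] at hs ht
  exact eq_of_erasePoint_eq (hs.2.trans ht.2.symm) hst

lemma interruptFreeExtensions_spec {n : ℕ} {r s : ℕ → ℕ} (h : s ∈ interruptFreeExtensions n r) :
    IsRep (n + 1) s ∧ NoInterrupt (n + 1) s ∧ ∀ i ≤ n, s i = r i := by
  simp only [interruptFreeExtensions, mem_filter, mem_interruptFree] at h
  exact ⟨h.1.1, h.1.2, fun i hi => by rw [← h.2, erasePoint_apply s hi]⟩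

lemma extension_value {n : ℕ} {s : ℕ → ℕ} (hs : IsRep (n + 1) s) :
    1 ≤ s (n + 1) ∧ s (n + 1) ≤ n + 1 ∧ s (s (n + 1)) = s (n + 1) :=
  have h : n + 1 ∈ Idx (n + 1) := mem_Idx.2 (by omega)
  ⟨hs.pos _ h, hs.le _ h, hs.idem _ h⟩

lemma card_interruptFreeExtensions_le_three {n : ℕ} (r : ℕ → ℕ) :
    #(interruptFreeExtensions n r) ≤ 3 := by
  classical
  set A := (interruptFreeExtensions n r).image (fun s => s (n + 1)) with hA
  have key : ∀ v ∈ A \ {n + 1, r n}, ∀ w ∈ A \ {n + 1, r n}, ¬ v < w := by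
    intro v hv w hw hvw
    simp only [hA, mem_sdiff, mem_image, mem_insert, mem_singleton, not_or] at hv hw
    obtain ⟨⟨s, hs, rfl⟩, hv1, hv2⟩ := hv
    obtain ⟨⟨t, ht, rfl⟩, hw1, hw2⟩ := hw
    obtain ⟨hs1, -, hs3⟩ := interruptFreeExtensions_spec hs
    obtain ⟨ht1, ht2, ht3⟩ := interruptFreeExtensions_spec ht
    obtain ⟨a1, a2, a3⟩ := extension_value hs1
    obtain ⟨b1, b2, b3⟩ := extension_value ht1
    have hne : t (n + 1) ≠ n := by
      intro h
      rw [h, ht3 n le_rfl] at b3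
      omega
    have e1 : t (s (n + 1)) = s (n + 1) := by
      rw [ht3 _ (by omega), ← hs3 _ (by omega), a3]
    have := ht2 (s (n + 1)) (t (n + 1)) n (n + 1) a1 hvw (by omega) (by omega) le_rfl b3
      (by omega) (by rw [b3, ht3 n le_rfl]; exact hw2)
    rw [e1, ht3 n le_rfl] at this
    exact hv2 this
  have h1 : #(A \ {n + 1, r n}) ≤ 1 := by
    rw [card_le_one]
    intro v hv w hw
    have := key v hv w hw
    have := key w hw v hv
    omega
  calc _ ≤ #A := card_interruptFreeExtensions_le fun s hs => mem_image_of_mem _ hs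
    _ ≤ #(A \ {n + 1, r n}) + #({n + 1, r n} : Finset ℕ) := card_le_card_sdiff_add_card
    _ ≤ 1 + 2 := Nat.add_le_add h1 card_le_two

/-- The representative function of the partition of `[n]` with a single block. -/
def oneBlockRep (n i : ℕ) : ℕ := if 1 ≤ i ∧ i ≤ n then 1 else 0

/-- The representative function of the partition `{1, n}, {2}, {3, …, n - 1}`. -/
def wrappedRep (n i : ℕ) : ℕ :=
  if i = 1 ∨ i = n then 1 else if i = 2 then 2 else if 3 ≤ i ∧ i < n then 3 else 0

lemma isRep_oneBlockRep (n : ℕ) : IsRep n (oneBlockRep n) := by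
  constructor <;> intro i hi <;> rw [mem_Idx] at hi <;> grind [oneBlockRep]

lemma isRep_wrappedRep {n : ℕ} (hn : 4 ≤ n) : IsRep n (wrappedRep n) := by
  constructor <;> intro i hi <;> rw [mem_Idx] at hi <;> grind [wrappedRep]

lemma oneBlockRep_mem_interruptFree (n : ℕ) : oneBlockRep n ∈ interruptFree n := by
  refine mem_interruptFree.2 ⟨isRep_oneBlockRep n, ?_⟩
  intro a b c d
  grind [oneBlockRep]

lemma oneBlockRep_mem_fewBlocks (n : ℕ) : oneBlockRep n ∈ fewBlocks n := by
  refine mem_fewBlocks.2 ⟨isRep_oneBlockRep n, ?_⟩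
  intro a ha b hb c hc d hd
  rw [mem_Idx] at ha hb
  left
  simp [oneBlockRep, ha, hb]

lemma wrappedRep_mem_interruptFree {n : ℕ} (hn : 4 ≤ n) : wrappedRep n ∈ interruptFree n := by
  refine mem_interruptFree.2 ⟨isRep_wrappedRep hn, ?_⟩
  intro a b c d
  grind [wrappedRep]

lemma card_interruptFreeExtensions_oneBlockRep_le (n : ℕ) :
    #(interruptFreeExtensions n (oneBlockRep n)) ≤ 2 := by
  refine (card_interruptFreeExtensions_le (V := {1, n + 1}) fun s hs => ?_).trans card_le_two
  obtain ⟨h1, -, h3⟩ := interruptFreeExtensions_spec hs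
  obtain ⟨a1, a2, a3⟩ := extension_value h1
  have := h3 (s (n + 1))
  rw [mem_insert, mem_singleton]
  grind [oneBlockRep]

lemma card_interruptFreeExtensions_wrappedRep_le {n : ℕ} (hn : 4 ≤ n) :
    #(interruptFreeExtensions n (wrappedRep n)) ≤ 2 := by
  refine (card_interruptFreeExtensions_le (V := {1, n + 1}) fun s hs => ?_).trans card_le_two
  obtain ⟨h1, h2, h3⟩ := interruptFreeExtensions_spec hs
  obtain ⟨a1, a2, a3⟩ := extension_value h1
  have e := h3 (s (n + 1))
  have e1 := h3 1 (by omega)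
  have e2 := h3 2 (by omega)
  have e3 := h3 3 (by omega)
  have en := h3 n le_rfl
  have p2 := h2 1 2 3 (n + 1) (by omega) (by omega) (by omega) (by omega) le_rfl
  have p3 := h2 2 3 n (n + 1) (by omega) (by omega)
  rw [mem_insert, mem_singleton]
  grind [wrappedRep]

lemma card_interruptFree_succ_add_card_le {n : ℕ} {S : Finset (ℕ → ℕ)} (hS : S ⊆ interruptFree n)
    (h : ∀ r ∈ S, #(interruptFreeExtensions n r) ≤ 2) :
    #(interruptFree (n + 1)) + #S ≤ 3 * #(interruptFree n) := by
  classical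
  have hs : #S = ∑ r ∈ interruptFree n, if r ∈ S then 1 else 0 := by
    rw [sum_ite_mem, inter_eq_right.2 hS, sum_const, smul_eq_mul, mul_one]
  rw [card_eq_sum_card_fiberwise (erasePoint_mapsTo_interruptFree n), hs, ← sum_add_distrib,
    mul_comm, ← smul_eq_mul, ← sum_const]
  refine sum_le_sum fun r _ => ?_
  have h3 := card_interruptFreeExtensions_le_three (n := n) r
  have h2 := h r
  unfold interruptFreeExtensions at h3 h2
  split_ifs with hr
  · exact Nat.add_le_add_right (by convert h2 hr) 1
  · rw [add_zero]
    convert h3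

lemma card_interruptFree_succ_add_one_le (n : ℕ) :
    #(interruptFree (n + 1)) + 1 ≤ 3 * #(interruptFree n) := by
  refine card_interruptFree_succ_add_card_le (S := {oneBlockRep n}) ?_ ?_
  · simpa using oneBlockRep_mem_interruptFree n
  · simpa using card_interruptFreeExtensions_oneBlockRep_le n

lemma card_interruptFree_succ_add_two_le {n : ℕ} (hn : 4 ≤ n) :
    #(interruptFree (n + 1)) + 2 ≤ 3 * #(interruptFree n) := by
  have hne : oneBlockRep n ≠ wrappedRep n := by
    intro h
    have := congrFun h 2
    grind [oneBlockRep, wrappedRep]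
  classical
  rw [← card_pair hne]
  refine card_interruptFree_succ_add_card_le ?_ ?_
  · simp [insert_subset_iff, oneBlockRep_mem_interruptFree, wrappedRep_mem_interruptFree hn]
  · simp [card_interruptFreeExtensions_oneBlockRep_le,
      card_interruptFreeExtensions_wrappedRep_le hn]

lemma update_mem_fewBlocks_old {n p : ℕ} {r : ℕ → ℕ} (hr : r ∈ fewBlocks n) (hp : p ∈ Idx n)
    (hrp : r p = p) : Function.update r (n + 1) p ∈ fewBlocks (n + 1) := by
  obtain ⟨h1, h2⟩ := mem_fewBlocks.1 hr
  have hp' := mem_Idx.1 hp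
  have hcase : ∀ i ∈ Idx (n + 1), ∃ j ∈ Idx n, Function.update r (n + 1) p i = r j ∧ j ≤ i := by
    intro i hi
    by_cases h : i = n + 1
    · exact ⟨p, hp, by simp [h, hrp], by omega⟩
    · have hi' : i ∈ Idx n := by rw [mem_Idx] at *; omega
      exact ⟨i, hi', by simp [h], le_rfl⟩
  refine mem_fewBlocks.2 ⟨⟨?_, ?_, ?_, ?_⟩, ?_⟩
  · intro i hi
    obtain ⟨j, hj, e, -⟩ := hcase i hi
    rw [e]; exact h1.pos j hj
  · intro i hi
    obtain ⟨j, hj, e, hji⟩ := hcase i hi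
    rw [e]; exact (h1.le j hj).trans hji
  · intro i hi
    obtain ⟨j, hj, e, -⟩ := hcase i hi
    have := (mem_Idx.1 (h1.mem hj)).2
    rw [e, Function.update_of_ne (by omega), h1.idem j hj]
  · intro i hi
    rw [mem_Idx] at hi
    rw [Function.update_of_ne (by omega)]
    exact h1.zero i (by rw [mem_Idx]; omega)
  · intro a ha b hb c hc d hd
    obtain ⟨a', ha', ea, -⟩ := hcase a ha
    obtain ⟨b', hb', eb, -⟩ := hcase b hb
    obtain ⟨c', hc', ec, -⟩ := hcase c hc
    obtain ⟨d', hd', ed, -⟩ := hcase d hd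
    rw [ea, eb, ec, ed]
    exact h2 a' ha' b' hb' c' hc' d' hd'

lemma update_mem_fewBlocks_new {n p q : ℕ} {r : ℕ → ℕ} (hr : IsRep n r)
    (hpq : ∀ i ∈ Idx n, r i = p ∨ r i = q) :
    Function.update r (n + 1) (n + 1) ∈ fewBlocks (n + 1) := by
  have hcase : ∀ i ∈ Idx (n + 1), (i = n + 1 ∧ Function.update r (n + 1) (n + 1) i = n + 1) ∨
      (i ∈ Idx n ∧ Function.update r (n + 1) (n + 1) i = r i) := by
    intro i hi
    by_cases h : i = n + 1
    · left; simp [h]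
    · right
      exact ⟨by rw [mem_Idx] at *; omega, by simp [h]⟩
  refine mem_fewBlocks.2 ⟨⟨?_, ?_, ?_, ?_⟩, ?_⟩
  · intro i hi
    obtain ⟨-, e⟩ | ⟨hi', e⟩ := hcase i hi
    · omega
    · rw [e]; exact hr.pos i hi'
  · intro i hi
    obtain ⟨h, e⟩ | ⟨hi', e⟩ := hcase i hi
    · omega
    · rw [e]; exact hr.le i hi'
  · intro i hi
    obtain ⟨h, e⟩ | ⟨hi', e⟩ := hcase i hi
    · rw [e, Function.update_self]
    · have := (mem_Idx.1 (hr.mem hi')).2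
      rw [e, Function.update_of_ne (by omega), hr.idem i hi']
  · intro i hi
    rw [mem_Idx] at hi
    rw [Function.update_of_ne (by omega)]
    exact hr.zero i (by rw [mem_Idx]; omega)
  · have h3 : ∀ i ∈ Idx (n + 1), Function.update r (n + 1) (n + 1) i = n + 1 ∨
        Function.update r (n + 1) (n + 1) i = p ∨ Function.update r (n + 1) (n + 1) i = q := by
      intro i hi
      obtain ⟨h, e⟩ | ⟨hi', e⟩ := hcase i hi
      · exact Or.inl e
      · rw [e]; exact Or.inr (hpq i hi')
    intro a ha b hb c hc d hd
    have := h3 a ha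
    have := h3 b hb
    have := h3 c hc
    have := h3 d hd
    omega

open scoped Classical in
lemma card_le_card_fewBlocks_fibre {n : ℕ} {r : ℕ → ℕ} (hr : IsRep n r) {V : Finset ℕ}
    (hV : ∀ v ∈ V, Function.update r (n + 1) v ∈ fewBlocks (n + 1)) :
    #V ≤ #{s ∈ fewBlocks (n + 1) | erasePoint (n + 1) s = r} := by
  refine card_le_card_of_injOn (fun v => Function.update r (n + 1) v) ?_ ?_
  · intro v hv
    simp only [coe_filter, Set.mem_ofPred_eq]
    refine ⟨hV v hv, ?_⟩
    have : r (n + 1) = 0 := hr.zero _ (by rw [mem_Idx]; omega)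
    rw [erasePoint, Function.update_idem, ← this, Function.update_eq_self]
  · exact (Function.update_injective r (n + 1)).injOn

open scoped Classical in
lemma three_le_card_fewBlocks_fibre_add {n : ℕ} (hn : 1 ≤ n) {r : ℕ → ℕ}
    (hr : r ∈ fewBlocks n) :
    3 ≤ #{s ∈ fewBlocks (n + 1) | erasePoint (n + 1) s = r} +
      if r = oneBlockRep n then 1 else 0 := by
  have h1 := (mem_fewBlocks.1 hr).1
  have m1 : 1 ∈ Idx n := mem_Idx.2 (by omega)
  have r1 : r 1 = 1 := le_antisymm (h1.le 1 m1) (h1.pos 1 m1)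
  have old1 := update_mem_fewBlocks_old hr m1 r1
  by_cases hc : ∀ i ∈ Idx n, r i = 1
  · have he : r = oneBlockRep n := by
      ext i
      by_cases hi : i ∈ Idx n
      · rw [hc i hi, oneBlockRep, if_pos (mem_Idx.1 hi)]
      · rw [h1.zero i hi, oneBlockRep, if_neg (mt mem_Idx.2 hi)]
    rw [if_pos he]
    have := update_mem_fewBlocks_new h1 (p := 1) (q := 1) fun i hi => Or.inl (hc i hi)
    have := card_le_card_fewBlocks_fibre h1 (V := {1, n + 1}) (by simp [old1, this])
    rw [card_pair (by omega)] at this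
    omega
  · push Not at hc
    obtain ⟨i, hi, hi1⟩ := hc
    have hp := mem_Idx.1 (h1.mem hi)
    have old2 := update_mem_fewBlocks_old hr (h1.mem hi) (h1.idem i hi)
    refine le_trans ?_ (Nat.le_add_right _ _)
    by_cases hq : ∀ j ∈ Idx n, r j = 1 ∨ r j = r i
    · have new := update_mem_fewBlocks_new h1 hq
      have := card_le_card_fewBlocks_fibre h1 (V := {1, r i, n + 1}) (by simp [old1, old2, new])
      rwa [card_eq_three.2 ⟨1, r i, n + 1, by omega, by omega, by omega, rfl⟩] at this
    · push Not at hq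
      obtain ⟨j, hj, hj1, hj2⟩ := hq
      have old3 := update_mem_fewBlocks_old hr (h1.mem hj) (h1.idem j hj)
      have := card_le_card_fewBlocks_fibre h1 (V := {1, r i, r j}) (by simp [old1, old2, old3])
      rwa [card_eq_three.2 ⟨1, r i, r j, by omega, by omega, by omega, rfl⟩] at this

lemma three_mul_card_fewBlocks_le {n : ℕ} (hn : 1 ≤ n) :
    3 * #(fewBlocks n) ≤ #(fewBlocks (n + 1)) + 1 := by
  classical
  have hs : (∑ r ∈ fewBlocks n, if r = oneBlockRep n then 1 else 0) = 1 := by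
    rw [sum_ite_eq', if_pos (oneBlockRep_mem_fewBlocks n)]
  have h := sum_le_sum fun r hr => three_le_card_fewBlocks_fibre_add hn (r := r) hr
  rw [sum_add_distrib, hs, sum_const, smul_eq_mul, mul_comm] at h
  rwa [card_eq_sum_card_fiberwise (erasePoint_mapsTo_fewBlocks n)]

lemma card_interruptFree_le_card_fewBlocks {n : ℕ} (hn : 1 ≤ n) :
    #(interruptFree n) ≤ #(fewBlocks n) := by
  induction n, hn using Nat.le_induction with
  | base =>
    have h1 : #(interruptFree 1) ≤ 1 := by
      rw [card_le_one]
      have key : ∀ r ∈ interruptFree 1, r = oneBlockRep 1 := by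
        intro r hr
        have h1 := (mem_interruptFree.1 hr).1
        ext i
        by_cases hi : i ∈ Idx 1
        · have hle := h1.le i hi
          have hpos := h1.pos i hi
          rw [mem_Idx] at hi
          rw [oneBlockRep, if_pos hi]
          omega
        · rw [h1.zero i hi, oneBlockRep, if_neg (mt mem_Idx.2 hi)]
      intro r hr s hs
      rw [key r hr, key s hs]
    exact h1.trans (card_pos.2 ⟨_, oneBlockRep_mem_fewBlocks 1⟩)
  | succ n hn ih =>
    have := card_interruptFree_succ_add_one_le n
    have := three_mul_card_fewBlocks_le hn
    omega

/-- For `n ≥ 5`, `|Π_n(1/24/3)| < |Π_n(1/2/3/4)|`. -/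
theorem avoidCount_1_24_3_lt_singletons (τ1 τ2 : Finpartition (Idx 4))
    (hτ1 : τ1.parts = {{1}, {2, 4}, {3}})
    (hτ2 : τ2.parts = {{1}, {2}, {3}, {4}}) :
    ∀ n : ℕ, 5 ≤ n → avoidCount n τ1 < avoidCount n τ2 := by
  intro n hn
  obtain ⟨m, rfl⟩ : ∃ m, n = m + 1 := ⟨n - 1, by omega⟩
  have h1 := avoidCount_le_card_interruptFree τ1 hτ1 (m + 1)
  have h2 := card_fewBlocks_le_avoidCount τ2 hτ2 (m + 1)
  have h3 := card_interruptFree_succ_add_two_le (n := m) (by omega)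
  have h4 := three_mul_card_fewBlocks_le (n := m) (by omega)
  have h5 := card_interruptFree_le_card_fewBlocks (n := m) (by omega)
  omega
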